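/- Let Θ: A → A⊗A be a k-linear map with Θ(1) = 0. The following are equivalent: (1) Θ is a double derivation, i.e., a derivation with values in A⊗A equipped with the outer bimodule structure; (2) the associated t-derivation Θ_t: A_t → A_t is a derivation of the algebra A_t vanishing on k[t]; (3) the k-linear endomorphism of A_t/(A_t⁺)² induced by id + Θ_t is an algebra automorphism. -/

import Mathlib

open scoped TensorProduct

noncomputable section

/-- The free product `A_t = A ∗ k[t]`: a `k`-algebra `C` equipped with an algebra map from
`A` and a distinguished element `t`, which is universal among such data; i.e. `C` is the
coproduct of `A` and the polynomial algebra `k[t]` in the category of unital associative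
`k`-algebras (an algebra map out of `k[t]` being the same as the choice of the image
of `t`). -/
structure FreeProductT (k : Type) [Field k] (A : Type) [Ring A] [Algebra k A] : Type 1 where
  C : Type
  [ringC : Ring C]
  [algC : Algebra k C]
  ιA : A →ₐ[k] C
  t : C
  univ : ∀ (D : Type) [Ring D] [Algebra k D] (f : A →ₐ[k] D) (x : D),
    ∃! g : C →ₐ[k] D, g.comp ιA = f ∧ g t = x

attribute [instance] FreeProductT.ringC FreeProductT.algC

/-- A bimodule over a `k`-algebra `C`: commuting left and right actions, encoded as
`k`-algebra maps `C → End_k(M)` and `Cᵐᵒᵖ → End_k(M)`. -/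
structure NCBimod (k : Type) [Field k] (C : Type) [Ring C] [Algebra k C] : Type 1 where
  M : Type
  [acg : AddCommGroup M]
  [mod : Module k M]
  l : C →ₐ[k] Module.End k M
  r : Cᵐᵒᵖ →ₐ[k] Module.End k M
  comm : ∀ (c c' : C) (m : M),
    l c (r (MulOpposite.op c') m) = r (MulOpposite.op c') (l c m)

attribute [instance] NCBimod.acg NCBimod.mod

variable {k A : Type} [Field k] [Ring A] [Algebra k A]

/-- `F : A_t → M` is a `t`-derivation: `F(1) = 0` and
`F(b₁·t·b₂) = F(b₁)·t·b₂ + b₁·t·F(b₂)`. -/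
def IsTDerivation (P : FreeProductT k A) (N : NCBimod k P.C) (F : P.C →ₗ[k] N.M) : Prop :=
  F 1 = 0 ∧ ∀ b₁ b₂ : P.C,
    F (b₁ * P.t * b₂) = N.r (MulOpposite.op (P.t * b₂)) (F b₁) + N.l (b₁ * P.t) (F b₂)

/-- `D : A_t → M` is a derivation. -/
def IsDerivation (P : FreeProductT k A) (N : NCBimod k P.C) (D : P.C →ₗ[k] N.M) : Prop :=
  ∀ x y : P.C, D (x * y) = N.r (MulOpposite.op y) (D x) + N.l x (D y)

/-- `f : A → M` is a derivation of `A` with coefficients in `M`, viewed as an `A`-bimodule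
by restriction along `A ⊂ A_t`. -/
def IsADerivation (P : FreeProductT k A) (N : NCBimod k P.C) (f : A →ₗ[k] N.M) : Prop :=
  ∀ a b : A, f (a * b) = N.r (MulOpposite.op (P.ιA b)) (f a) + N.l (P.ιA a) (f b)

namespace FreeProductT

variable {k A : Type} [Field k] [Ring A] [Algebra k A] (P : FreeProductT k A)

/-- The map `A ⊗ A → A_t`, `a' ⊗ a'' ↦ a'·t·a''`. -/
def psi : (A ⊗[k] A) →ₗ[k] P.C :=
  TensorProduct.lift (LinearMap.mk₂ k (fun a' a'' => P.ιA a' * P.t * P.ιA a'')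
    (fun a b c => by simp [map_add, add_mul])
    (fun c a b => by simp [map_smul, smul_mul_assoc])
    (fun a b c => by simp [map_add, mul_add])
    (fun c a b => by simp [map_smul, mul_smul_comm]))

/-- The two-sided ideal `A_t⁺ = A_t·t·A_t` of `A_t` generated by `t`. -/
def idealT : TwoSidedIdeal P.C :=
  TwoSidedIdeal.span {w : P.C | ∃ u v : P.C, w = u * P.t * v}

/-- The two-sided ideal `(A_t⁺)²`. -/
def idealT2 : TwoSidedIdeal P.C :=
  TwoSidedIdeal.span {w : P.C | ∃ u v u' : P.C, w = u * P.t * v * P.t * u'}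

/-- The quotient algebra `A_t/(A_t⁺)²`. -/
abbrev QuotT2 : Type := P.idealT2.ringCon.Quotient

/-- The quotient ring homomorphism `A_t → A_t/(A_t⁺)²`. -/
def mkT2 : P.C →+* P.QuotT2 := P.idealT2.ringCon.mk'

instance : Algebra k P.QuotT2 :=
  RingHom.toAlgebra' (P.mkT2.comp (algebraMap k P.C)) (fun c q => by
    induction q using Quotient.inductionOn' with
    | h x =>
      show P.mkT2 (algebraMap k P.C c) * P.mkT2 x
          = P.mkT2 x * P.mkT2 (algebraMap k P.C c)
      rw [← map_mul, ← map_mul, Algebra.commutes])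

end FreeProductT

namespace FreeProductT

variable {k A : Type} [Field k] [Ring A] [Algebra k A] (P : FreeProductT k A)

@[simp]
lemma psi_tmul (a b : A) : P.psi (a ⊗ₜ[k] b) = P.ιA a * P.t * P.ιA b := rfl

lemma psi_mulRight (b : A) (w : A ⊗[k] A) :
    P.psi (TensorProduct.map LinearMap.id (LinearMap.mulRight k b) w) = P.psi w * P.ιA b := by
  induction w using TensorProduct.induction_on with
  | zero => simp
  | tmul x y => simp [mul_assoc]
  | add x y hx hy => simp [hx, hy, add_mul]

lemma psi_mulLeft (a : A) (w : A ⊗[k] A) :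
    P.psi (TensorProduct.map (LinearMap.mulLeft k a) LinearMap.id w) = P.ιA a * P.psi w := by
  induction w using TensorProduct.induction_on with
  | zero => simp
  | tmul x y => simp [mul_assoc]
  | add x y hx hy => simp [hx, hy, mul_add]

/-- The free product is generated by `A` and `t`. -/
lemma adjoin_eq_top : Algebra.adjoin k (Set.range P.ιA ∪ {P.t}) = ⊤ := by
  set S := Algebra.adjoin k (Set.range P.ιA ∪ {P.t}) with hS
  have hA (a : A) : P.ιA a ∈ S := Algebra.subset_adjoin (Or.inl ⟨a, rfl⟩)
  have ht : P.t ∈ S := Algebra.subset_adjoin (Or.inr rfl)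
  obtain ⟨g, ⟨hgA, hgt⟩, -⟩ := P.univ S (P.ιA.codRestrict S hA) ⟨P.t, ht⟩
  have hg : S.val.comp g = AlgHom.id k P.C := by
    refine (P.univ P.C P.ιA P.t).unique ⟨?_, ?_⟩ ⟨rfl, rfl⟩
    · rw [AlgHom.comp_assoc, hgA]
      rfl
    · simp [hgt]
  refine eq_top_iff.2 fun x _ => ?_
  have hx : ((g x : S) : P.C) = x := DFunLike.congr_fun hg x
  exact hx ▸ (g x).2

@[elab_as_elim]
lemma induction_on {p : P.C → Prop} (x : P.C) (ι : ∀ a, p (P.ιA a)) (t : p P.t)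
    (add : ∀ x y, p x → p y → p (x + y)) (mul : ∀ x y, p x → p y → p (x * y)) : p x := by
  have hx : x ∈ Algebra.adjoin k (Set.range P.ιA ∪ {P.t}) := by
    rw [P.adjoin_eq_top]; trivial
  induction hx using Algebra.adjoin_induction with
  | mem x hx =>
    rcases hx with ⟨a, rfl⟩ | rfl
    exacts [ι a, t]
  | algebraMap r => exact P.ιA.commutes r ▸ ι _
  | add x y _ _ hx hy => exact add x y hx hy
  | mul x y _ _ hx hy => exact mul x y hx hy

/-- The representation of `A_t` on `(A ⊗ A) × A` in which `A` acts by left multiplication and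
`t` acts by `(w, a) ↦ (1 ⊗ a, 0)`. -/
def rep : P.C →ₐ[k] Module.End k ((A ⊗[k] A) × A) :=
  (P.univ _ (Algebra.lsmul k k ((A ⊗[k] A) × A))
    (LinearMap.inl k (A ⊗[k] A) A ∘ₗ TensorProduct.mk k A A 1 ∘ₗ
      LinearMap.snd k (A ⊗[k] A) A)).choose

lemma rep_ι (a : A) (v : (A ⊗[k] A) × A) : P.rep (P.ιA a) v = a • v :=
  DFunLike.congr_fun (DFunLike.congr_fun (P.univ _ (Algebra.lsmul k k ((A ⊗[k] A) × A))
    (LinearMap.inl k (A ⊗[k] A) A ∘ₗ TensorProduct.mk k A A 1 ∘ₗ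
      LinearMap.snd k (A ⊗[k] A) A)).choose_spec.1.1 a) v

lemma rep_t (v : (A ⊗[k] A) × A) : P.rep P.t v = (1 ⊗ₜ v.2, 0) :=
  DFunLike.congr_fun (P.univ _ (Algebra.lsmul k k ((A ⊗[k] A) × A))
    (LinearMap.inl k (A ⊗[k] A) A ∘ₗ TensorProduct.mk k A A 1 ∘ₗ
      LinearMap.snd k (A ⊗[k] A) A)).choose_spec.1.2 v

lemma rep_psi (w : A ⊗[k] A) : P.rep (P.psi w) (0, 1) = (w, 0) := by
  induction w using TensorProduct.induction_on with
  | zero => rw [map_zero, map_zero]; rfl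
  | tmul x y => simp [rep_ι, rep_t, TensorProduct.smul_tmul']
  | add x y hx hy => simp [hx, hy]

lemma rep_snd_eq_zero (c : P.C) : ∀ v : (A ⊗[k] A) × A, v.2 = 0 → (P.rep c v).2 = 0 := by
  induction c using P.induction_on with
  | ι a => intro v hv; simp [rep_ι, hv]
  | t => intro v _; simp [rep_t]
  | add x y hx hy => intro v hv; simp [hx v hv, hy v hv]
  | mul x y hx hy => intro v hv; simpa using hx _ (hy v hv)

lemma rep_eq_zero_of_mem_idealT2 {x : P.C} (hx : x ∈ P.idealT2) : P.rep x = 0 := by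
  have h : P.idealT2 ≤ TwoSidedIdeal.ker P.rep := by
    refine TwoSidedIdeal.span_le.2 ?_
    rintro _ ⟨u, v, u', rfl⟩
    refine (TwoSidedIdeal.mem_ker _).2 (LinearMap.ext fun z => ?_)
    have hv := P.rep_snd_eq_zero v (P.rep P.t (P.rep u' z)) (by simp [rep_t])
    simp only [map_mul, Module.End.mul_apply]
    rw [P.rep_t (P.rep v _), hv, TensorProduct.tmul_zero]
    exact map_zero _
  exact (TwoSidedIdeal.mem_ker _).1 (h hx)

lemma eq_zero_of_psi_mem_idealT2 {w : A ⊗[k] A} (hw : P.psi w ∈ P.idealT2) : w = 0 := by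
  have h := P.rep_psi w
  rw [P.rep_eq_zero_of_mem_idealT2 hw] at h
  exact (congrArg Prod.fst h).symm

lemma psi_injective : Function.Injective P.psi :=
  (injective_iff_map_eq_zero P.psi).2 fun _ hw =>
    P.eq_zero_of_psi_mem_idealT2 (hw ▸ P.idealT2.zero_mem)

lemma mkT2_eq_iff {x y : P.C} : P.mkT2 x = P.mkT2 y ↔ x - y ∈ P.idealT2 := by
  rw [← TwoSidedIdeal.rel_iff]
  exact RingCon.eq _

lemma mul_t_mul_mem_idealT (u v : P.C) : u * P.t * v ∈ P.idealT :=
  TwoSidedIdeal.subset_span ⟨u, v, rfl⟩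

lemma psi_mem_idealT (w : A ⊗[k] A) : P.psi w ∈ P.idealT := by
  induction w using TensorProduct.induction_on with
  | zero => simp
  | tmul x y => exact P.mul_t_mul_mem_idealT _ _
  | add x y hx hy => simpa using P.idealT.add_mem hx hy

lemma idealT2_le_idealT : P.idealT2 ≤ P.idealT := by
  refine TwoSidedIdeal.span_le.2 ?_
  rintro _ ⟨u, v, u', rfl⟩
  exact P.mul_t_mul_mem_idealT _ _

lemma mul_mem_idealT2 {x y : P.C} (hx : x ∈ P.idealT) (hy : y ∈ P.idealT) :
    x * y ∈ P.idealT2 := by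
  have key : ∀ u v : P.C, u * P.t * v * y ∈ P.idealT2 := by
    induction hy using TwoSidedIdeal.span_induction with
    | mem y hy =>
      obtain ⟨u', v', rfl⟩ := hy
      exact fun u v => TwoSidedIdeal.subset_span ⟨u, v * u', v', by simp only [mul_assoc]⟩
    | zero => simp
    | add x y _ _ hx hy =>
      exact fun u v => mul_add (u * P.t * v) x y ▸ P.idealT2.add_mem (hx u v) (hy u v)
    | neg x _ hx => exact fun u v => mul_neg (u * P.t * v) x ▸ P.idealT2.neg_mem (hx u v)
    | left_absorb a x _ hx => exact fun u v => by simpa only [mul_assoc] using hx u (v * a)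
    | right_absorb b x _ hx =>
      exact fun u v => mul_assoc (u * P.t * v) x b ▸ P.idealT2.mul_mem_right _ b (hx u v)
  suffices h : ∀ c : P.C, x * (c * y) ∈ P.idealT2 by simpa using h 1
  induction hx using TwoSidedIdeal.span_induction with
  | mem x hx =>
    obtain ⟨u, v, rfl⟩ := hx
    exact fun c => by simpa only [mul_assoc] using key u (v * c)
  | zero => simp
  | add x y _ _ hx hy => exact fun c => add_mul x y _ ▸ P.idealT2.add_mem (hx c) (hy c)
  | neg x _ hx => exact fun c => neg_mul x _ ▸ P.idealT2.neg_mem (hx c)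
  | left_absorb a x _ hx =>
    exact fun c => (mul_assoc a x _).symm ▸ P.idealT2.mul_mem_left a _ (hx c)
  | right_absorb b x _ hx => exact fun c => by simpa only [mul_assoc] using hx (b * c)

section Derivation

variable {P} {D : P.C →ₗ[k] P.C} (hD : ∀ x y : P.C, D (x * y) = D x * y + x * D y)
  (ht : D P.t = 0) (hA : ∀ a : A, D (P.ιA a) ∈ P.idealT)

include hD

lemma derivation_one : D 1 = 0 := by
  simpa using hD 1 1

lemma derivation_algebraMap (r : k) : D (algebraMap k P.C r) = 0 := by
  rw [Algebra.algebraMap_eq_smul_one, map_smul, derivation_one hD, smul_zero]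

include ht hA

lemma derivation_mem_idealT (x : P.C) : D x ∈ P.idealT := by
  induction x using P.induction_on with
  | ι a => exact hA a
  | t => exact ht ▸ P.idealT.zero_mem
  | add x y hx hy => exact map_add D x y ▸ P.idealT.add_mem hx hy
  | mul x y hx hy =>
    exact hD x y ▸ P.idealT.add_mem (P.idealT.mul_mem_right _ _ hx) (P.idealT.mul_mem_left _ _ hy)

lemma derivation_mem_idealT2 {x : P.C} (hx : x ∈ P.idealT) : D x ∈ P.idealT2 := by
  have hDI := derivation_mem_idealT hD ht hA
  have htI : P.t ∈ P.idealT := by simpa using P.mul_t_mul_mem_idealT 1 1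
  induction hx using TwoSidedIdeal.span_induction with
  | mem x hx =>
    obtain ⟨u, v, rfl⟩ := hx
    rw [hD, hD, ht, mul_zero, add_zero]
    exact P.idealT2.add_mem (P.idealT2.mul_mem_right _ _ (P.mul_mem_idealT2 (hDI u) htI))
      (P.mul_mem_idealT2 (P.idealT.mul_mem_left _ _ htI) (hDI v))
  | zero => simp
  | add x y _ _ hx hy => exact map_add D x y ▸ P.idealT2.add_mem hx hy
  | neg x _ hx => exact map_neg D x ▸ P.idealT2.neg_mem hx
  | left_absorb a x h hx =>
    exact hD a x ▸ P.idealT2.add_mem (P.mul_mem_idealT2 (hDI a) h) (P.idealT2.mul_mem_left _ _ hx)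
  | right_absorb b x h hx =>
    exact hD x b ▸ P.idealT2.add_mem (P.idealT2.mul_mem_right _ _ hx) (P.mul_mem_idealT2 h (hDI b))

/-- For a derivation `D` of `A_t` with `D t = 0` and `D A ⊆ A_t⁺`, the map `id + D` induces an
algebra endomorphism of `A_t/(A_t⁺)²`. -/
lemma exists_algHom_id_add :
    ∃ φ : P.QuotT2 →ₐ[k] P.QuotT2, ∀ x : P.C, φ (P.mkT2 x) = P.mkT2 (x + D x) := by
  have hDI := derivation_mem_idealT hD ht hA
  let f : P.C →+* P.QuotT2 :=
    { toFun := fun x => P.mkT2 (x + D x)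
      map_one' := by rw [derivation_one hD, add_zero, map_one]
      map_zero' := by simp
      map_add' := fun x y => by simp only [map_add]; abel
      map_mul' := fun x y => by
        rw [← map_mul, mkT2_eq_iff, hD]
        have h := P.idealT2.neg_mem (P.mul_mem_idealT2 (hDI x) (hDI y))
        convert h using 1
        noncomm_ring }
  have hf : P.idealT2.ringCon ≤ RingCon.ker f := by
    intro x y hxy
    have hxy := (TwoSidedIdeal.rel_iff _ _ _).1 hxy
    refine (RingCon.ker_apply f).2 (P.mkT2_eq_iff.2 ?_)
    have h := P.idealT2.add_mem hxy
      (derivation_mem_idealT2 hD ht hA (P.idealT2_le_idealT hxy))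
    convert h using 1
    rw [map_sub]
    abel
  refine ⟨{ P.idealT2.ringCon.lift f hf with commutes' := fun r => ?_ }, fun x => rfl⟩
  change P.mkT2 (algebraMap k P.C r + D (algebraMap k P.C r)) = P.mkT2 (algebraMap k P.C r)
  rw [derivation_algebraMap hD, add_zero]

/-- For a derivation `D` of `A_t` with `D t = 0` and `D A ⊆ A_t⁺`, the map `id + D` induces an
algebra automorphism of `A_t/(A_t⁺)²`, with inverse induced by `id - D`. -/
lemma exists_algEquiv_id_add :
    ∃ φ : P.QuotT2 ≃ₐ[k] P.QuotT2, ∀ x : P.C, φ (P.mkT2 x) = P.mkT2 (x + D x) := by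
  obtain ⟨φ, hφ⟩ := exists_algHom_id_add hD ht hA
  obtain ⟨χ, hχ⟩ := exists_algHom_id_add (D := -D)
    (fun x y => by simp only [LinearMap.neg_apply, hD]; noncomm_ring) (by simp [ht])
    (fun a => P.idealT.neg_mem (hA a))
  have hDD (x : P.C) : D (D x) ∈ P.idealT2 :=
    derivation_mem_idealT2 hD ht hA (derivation_mem_idealT hD ht hA x)
  have hs : Function.Surjective P.mkT2 := RingCon.mk'_surjective _
  refine ⟨AlgEquiv.ofAlgHom φ χ (AlgHom.ext fun q => ?_) (AlgHom.ext fun q => ?_), hφ⟩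
  all_goals
    obtain ⟨x, rfl⟩ := hs q
    simp only [AlgHom.comp_apply, AlgHom.id_apply, hφ, hχ, LinearMap.neg_apply, mkT2_eq_iff]
    convert P.idealT2.neg_mem (hDD x) using 1
    simp only [map_add, map_neg]
    abel

end Derivation

/-- A `t`-derivation of `A_t` that satisfies the Leibniz rule on products of elements of `A`
is a derivation. -/
lemma leibniz_of_tDerivation {D : P.C →ₗ[k] P.C} (h1 : D 1 = 0)
    (ht : ∀ b₁ b₂ : P.C, D (b₁ * P.t * b₂) = D b₁ * P.t * b₂ + b₁ * P.t * D b₂)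
    (hA : ∀ a b : A, D (P.ιA (a * b)) = D (P.ιA a) * P.ιA b + P.ιA a * D (P.ιA b))
    (x y : P.C) : D (x * y) = D x * y + x * D y := by
  have left (y : P.C) (a : A) : D (P.ιA a * y) = D (P.ιA a) * y + P.ιA a * D y := by
    suffices h : ∀ z : P.C, (∀ a, D (P.ιA a * z) = D (P.ιA a) * z + P.ιA a * D z) →
        ∀ a, D (P.ιA a * (y * z)) = D (P.ιA a) * (y * z) + P.ιA a * D (y * z) by
      simpa using h 1 (by simp [h1]) a
    induction y using P.induction_on with
    | ι b =>
      intro z hz a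
      rw [← mul_assoc, ← map_mul, hz, hA, hz, map_mul]
      noncomm_ring
    | t =>
      intro z _ a
      have h := ht 1 z
      rw [one_mul, h1, zero_mul, zero_mul, zero_add] at h
      rw [← mul_assoc, ht, h]
      noncomm_ring
    | add u v hu hv =>
      intro z hz a
      simp only [add_mul, mul_add, map_add, hu z hz a, hv z hz a]
      abel
    | mul u v hu hv =>
      intro z hz a
      simpa only [mul_assoc] using hu (v * z) (hv z hz) a
  induction x using P.induction_on generalizing y with
  | ι a => exact left y a
  | t =>
    have hDt : D P.t = 0 := by simpa [h1] using ht 1 1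
    simpa [h1, hDt] using ht 1 y
  | add u v hu hv =>
    simp only [add_mul, map_add, hu y, hv y]
    abel
  | mul u v hu hv =>
    rw [mul_assoc, hu, hv, hu v]
    noncomm_ring

end FreeProductT

/-- Let `Θ : A → A⊗A` be a `k`-linear map with `Θ(1) = 0`, and let
`Θ_t : A_t → A_t` be the associated `t`-derivation (the unique `t`-derivation whose
restriction to `A` is `a ↦ Θ'(a)·t·Θ''(a)`). The following are equivalent:
(1) `Θ` is a double derivation (a derivation valued in the outer bimodule `A⊗A`);
(2) `Θ_t` is a derivation of `A_t` vanishing on `k[t]`;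
(3) the `k`-linear endomorphism of `A_t/(A_t⁺)²` induced by `id + Θ_t` is an algebra
automorphism. -/
theorem double_derivation_tfae
    {k A : Type} [Field k] [CharZero k] [Ring A] [Algebra k A]
    (P : FreeProductT k A)
    (Θ : A →ₗ[k] (A ⊗[k] A)) (hΘ1 : Θ 1 = 0)
    (Θt : P.C →ₗ[k] P.C)
    (hΘt1 : Θt 1 = 0)
    (hΘtt : ∀ b₁ b₂ : P.C, Θt (b₁ * P.t * b₂) = Θt b₁ * P.t * b₂ + b₁ * P.t * Θt b₂)
    (hΘtA : ∀ a : A, Θt (P.ιA a) = P.psi (Θ a)) :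
    ((∀ a b : A, Θ (a * b)
        = (TensorProduct.map LinearMap.id (LinearMap.mulRight k b)) (Θ a)
          + (TensorProduct.map (LinearMap.mulLeft k a) LinearMap.id) (Θ b))
      ↔ ((∀ x y : P.C, Θt (x * y) = Θt x * y + x * Θt y)
          ∧ ∀ x ∈ Algebra.adjoin k ({P.t} : Set P.C), Θt x = 0))
    ∧ ((∀ a b : A, Θ (a * b)
        = (TensorProduct.map LinearMap.id (LinearMap.mulRight k b)) (Θ a)
          + (TensorProduct.map (LinearMap.mulLeft k a) LinearMap.id) (Θ b))
      ↔ ∃ φ : P.QuotT2 ≃ₐ[k] P.QuotT2,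
          ∀ x : P.C, φ (P.mkT2 x) = P.mkT2 (x + Θt x)) := by
  have htt : Θt P.t = 0 := by simpa [hΘt1] using hΘtt 1 1
  have hmem (a : A) : Θt (P.ιA a) ∈ P.idealT := hΘtA a ▸ P.psi_mem_idealT _
  have leibniz (h : ∀ a b : A, Θ (a * b)
      = (TensorProduct.map LinearMap.id (LinearMap.mulRight k b)) (Θ a)
        + (TensorProduct.map (LinearMap.mulLeft k a) LinearMap.id) (Θ b)) (x y : P.C) :
      Θt (x * y) = Θt x * y + x * Θt y :=
    P.leibniz_of_tDerivation hΘt1 hΘtt (fun a b => by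
      rw [hΘtA, hΘtA, hΘtA, h, map_add, P.psi_mulRight, P.psi_mulLeft]) x y
  refine ⟨⟨fun h => ⟨leibniz h, fun x hx => ?_⟩, fun ⟨h, _⟩ a b => P.psi_injective ?_⟩,
    fun h => FreeProductT.exists_algEquiv_id_add (leibniz h) htt hmem, fun ⟨φ, hφ⟩ a b => ?_⟩
  · induction hx using Algebra.adjoin_induction with
    | mem x hx => exact (Set.mem_singleton_iff.1 hx).symm ▸ htt
    | algebraMap r => exact FreeProductT.derivation_algebraMap (leibniz h) r
    | add x y _ _ hx hy => rw [map_add, hx, hy, add_zero]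
    | mul x y _ _ hx hy => rw [leibniz h, hx, hy, zero_mul, mul_zero, add_zero]
  · rw [map_add, P.psi_mulRight, P.psi_mulLeft, ← hΘtA, ← hΘtA, ← hΘtA, map_mul, h]
  · have h : P.mkT2 (P.ιA a * P.ιA b + Θt (P.ιA a * P.ιA b))
        = P.mkT2 ((P.ιA a + Θt (P.ιA a)) * (P.ιA b + Θt (P.ιA b))) := by
      rw [← hφ, map_mul, map_mul, map_mul, hφ, hφ]
    have h := P.idealT2.add_mem (P.mkT2_eq_iff.1 h) (P.mul_mem_idealT2 (hmem a) (hmem b))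
    refine sub_eq_zero.1 (P.eq_zero_of_psi_mem_idealT2 ?_)
    convert h using 1
    rw [map_sub, map_add, P.psi_mulRight, P.psi_mulLeft, ← hΘtA, ← hΘtA, ← hΘtA, map_mul]
    noncomm_ring
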